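/- arXiv:2511.12887 — 2 statements merged into one kernel-verified Lean document; each statement's English description precedes it below -/
import Mathlib

section
/- Let d ≥ 2, N, M ≥ 2 be integers with N(M−1) = d²−1, let {E_{α,k}} be an informationally complete (N,M)-POVM on ℂ^d with parameter x, let O^{(1)},…,O^{(N)} be M×M real orthogonal matrices each fixing the all-ones vector, let 1 ≤ k ≤ d, let h_x = (1/(kd−1))·√(M(M−1)/(x(M²x−d))), and let W_k be the associated witness operator. Then for every d²×d² density matrix ρ with Schmidt number at most k (i.e., ρ is a finite convex combination ∑_i p_i |ψ_i⟩⟨ψ_i| of pure states ψ_i ∈ ℂ^d ⊗ ℂ^d of Schmidt rank at most k), one has Tr(W_k ρ) ≥ 0. -/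
open Matrix Kronecker
open scoped ComplexOrder

noncomputable section

/-- Informationally complete (N,M)-POVM on ℂ^d with parameter x. -/
def IsICPOVM (d N M : ℕ) (x : ℝ)
    (E : Fin N → Fin M → Matrix (Fin d) (Fin d) ℂ) : Prop :=
  (∀ α k, (E α k).PosSemidef) ∧
  (∀ α, ∑ k, E α k = 1) ∧
  (∀ α k, (E α k).trace = (d : ℂ) / M) ∧
  (∀ α k, (E α k * E α k).trace = (x : ℂ)) ∧
  (∀ α k l, k ≠ l → (E α k * E α l).trace = ((d : ℂ) - M * x) / (M * (M - 1))) ∧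
  (∀ α β k l, α ≠ β → (E α k * E β l).trace = (d : ℂ) / (M : ℂ) ^ 2) ∧
  ((d : ℝ) / (M : ℝ) ^ 2 < x ∧ x ≤ min ((d : ℝ) ^ 2 / (M : ℝ) ^ 2) ((d : ℝ) / M))

/-- The constant h_x. -/
def hx (d M k : ℕ) (x : ℝ) : ℝ :=
  (1 / ((k : ℝ) * d - 1)) *
    Real.sqrt (((M : ℝ) * ((M : ℝ) - 1)) / (x * ((M : ℝ) ^ 2 * x - d)))

/-- The linear map Λ associated to the POVM, the rotations and the constant h. -/
def LamMap {d N M : ℕ} (E : Fin N → Fin M → Matrix (Fin d) (Fin d) ℂ)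
    (O : Fin N → Matrix (Fin M) (Fin M) ℝ) (h : ℝ)
    (X : Matrix (Fin d) (Fin d) ℂ) : Matrix (Fin d) (Fin d) ℂ :=
  (X.trace / d) • 1 -
    (h : ℂ) • ∑ α, ∑ g, ∑ l,
      ((O α g l : ℝ) : ℂ) • (((X - (X.trace / d) • 1) * E α l).trace • E α g)

/-- (id ⊗ Λ) acting on matrices on ℂ^d ⊗ ℂ^d. -/
def idTensor {d : ℕ} (Λ : Matrix (Fin d) (Fin d) ℂ → Matrix (Fin d) (Fin d) ℂ)
    (ρ : Matrix (Fin d × Fin d) (Fin d × Fin d) ℂ) :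
    Matrix (Fin d × Fin d) (Fin d × Fin d) ℂ :=
  Matrix.of fun p q => Λ (Matrix.of fun a b => ρ (p.1, a) (q.1, b)) p.2 q.2

/-- Rank-one projection |ψ⟩⟨ψ|. -/
def proj {n : Type*} (ψ : n → ℂ) : Matrix n n ℂ := Matrix.vecMulVec ψ (star ψ)

/-- The maximally entangled vector of Schmidt rank k, rotated by U ⊗ V. -/
def psiK (d k : ℕ) (U V : Matrix (Fin d) (Fin d) ℂ) : Fin d × Fin d → ℂ :=
  (U ⊗ₖ V).mulVec fun p =>
    if p.1 = p.2 ∧ (p.1 : ℕ) < k then (((1 : ℝ) / Real.sqrt k : ℝ) : ℂ) else 0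

/-- The Schmidt-number witness W_k. -/
def Wit {d N M : ℕ} (E : Fin N → Fin M → Matrix (Fin d) (Fin d) ℂ)
    (O : Fin N → Matrix (Fin M) (Fin M) ℝ) (h : ℝ) :
    Matrix (Fin d × Fin d) (Fin d × Fin d) ℂ :=
  ((((M : ℝ) + N * d * h) / (d * M) : ℝ) : ℂ) • 1 -
    (h : ℂ) • ∑ α, ∑ g, ∑ l,
      ((O α g l : ℝ) : ℂ) • ((E α l).map (starRingEnd ℂ) ⊗ₖ E α g)

/-- ρ has Schmidt number at most k. -/
def SchmidtNumberLE (d k : ℕ) (ρ : Matrix (Fin d × Fin d) (Fin d × Fin d) ℂ) : Prop :=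
  ∃ (n : ℕ) (p : Fin n → ℝ) (ψ : Fin n → (Fin d × Fin d → ℂ)),
    (∀ i, 0 ≤ p i) ∧ (∑ i, p i = 1) ∧
    (∀ i, ∑ q, ‖ψ i q‖ ^ 2 = 1) ∧
    (∀ i, (Matrix.of fun a b => ψ i (a, b)).rank ≤ k) ∧
    ρ = ∑ i, ((p i : ℝ) : ℂ) • proj (ψ i)

/-- The maximally entangled vector |ψ_d⟩. -/
def psiD (d : ℕ) : Fin d × Fin d → ℂ :=
  fun p => if p.1 = p.2 then (((1 : ℝ) / Real.sqrt d : ℝ) : ℂ) else 0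

/-- The isotropic state ρ_v. -/
def isoState (d : ℕ) (v : ℝ) : Matrix (Fin d × Fin d) (Fin d × Fin d) ℂ :=
  (v : ℂ) • proj (psiD d) + (((1 - v) / (d : ℝ) ^ 2 : ℝ) : ℂ) • 1

/-- Bessel's inequality for a tight frame of Hermitian matrices with frame bound `a`. -/
lemma sum_norm_trace_mul_sq_le {ι n : Type*} [Fintype ι] [Fintype n]
    {F : ι → Matrix n n ℂ} (hF : ∀ i, (F i).IsHermitian) {a : ℝ} (ha : 0 < a) (X : Matrix n n ℂ)
    (h : ∀ i, ∑ j, (F i * F j).trace * (F j * X).trace = a * (F i * X).trace) :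
    ∑ i, ‖(F i * X).trace‖ ^ 2 ≤ a * (Xᴴ * X).trace.re := by
  set c : ι → ℂ := fun i => (F i * X).trace with hc
  have hconj : ∀ i, (Xᴴ * F i).trace = star (c i) := fun i => by
    rw [hc, ← trace_conjTranspose, conjTranspose_mul, (hF i).eq]
  have hD : (((a : ℂ) • X - ∑ i, c i • F i)ᴴ * ((a : ℂ) • X - ∑ i, c i • F i)).trace
      = a ^ 2 * (Xᴴ * X).trace - a * ∑ i, star (c i) * c i := by
    have h1 : ∑ i, star (c i) * ∑ j, (F i * F j).trace * c j = a * ∑ i, star (c i) * c i := by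
      rw [Finset.mul_sum]
      refine Finset.sum_congr rfl fun i _ => ?_
      rw [h i]; ring
    have h2 : ∑ i, star (c i) * ∑ j, (F i * F j).trace * c j
        = (((∑ i, c i • F i)ᴴ) * (∑ i, c i • F i)).trace := by
      simp only [conjTranspose_sum, conjTranspose_smul, (hF _).eq, Finset.sum_mul, Finset.mul_sum,
        trace_sum, smul_mul_assoc, mul_smul_comm, trace_smul, smul_eq_mul]
      rw [Finset.sum_comm]
      exact Finset.sum_congr rfl fun i _ => Finset.sum_congr rfl fun j _ => by ring
    have h3 : (Xᴴ * ∑ i, c i • F i).trace = ∑ i, star (c i) * c i := by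
      simp only [Finset.mul_sum, trace_sum, mul_smul_comm, trace_smul, smul_eq_mul, hconj]
      exact Finset.sum_congr rfl fun i _ => by ring
    have h4 : ((∑ i, c i • F i)ᴴ * X).trace = ∑ i, star (c i) * c i := by
      simp only [conjTranspose_sum, conjTranspose_smul, (hF _).eq, Finset.sum_mul,
        trace_sum, smul_mul_assoc, trace_smul, smul_eq_mul, hc]
    simp only [conjTranspose_sub, sub_mul, mul_sub, trace_sub, conjTranspose_smul, smul_mul_assoc,
      mul_smul_comm, trace_smul, smul_eq_mul, h3, h4, ← h2, h1]
    simp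
    ring
  have hpos : 0 ≤ (((a : ℂ) • X - ∑ i, c i • F i)ᴴ * ((a : ℂ) • X - ∑ i, c i • F i)).trace.re :=
    (Complex.le_def.1 (posSemidef_conjTranspose_mul_self _).trace_nonneg).1
  have hs : ∑ i, star (c i) * c i = ((∑ i, ‖c i‖ ^ 2 : ℝ) : ℂ) := by
    push_cast
    exact Finset.sum_congr rfl fun i _ => by simp [Complex.conj_mul']
  rw [hD, hs, ← Complex.ofReal_pow, Complex.sub_re, Complex.re_ofReal_mul, Complex.re_ofReal_mul,
    Complex.ofReal_re] at hpos
  have : 0 ≤ a * (a * (Xᴴ * X).trace.re - ∑ i, ‖c i‖ ^ 2) := by linarith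
  linarith [nonneg_of_mul_nonneg_right this ha]

/-- Bessel's inequality for a tight frame of the traceless Hermitian matrices. -/
lemma sum_norm_trace_mul_sq_le_of_trace_eq_zero {ι n : Type*} [Fintype ι] [Fintype n]
    [DecidableEq n] [Nonempty n] {F : ι → Matrix n n ℂ} (hF : ∀ i, (F i).IsHermitian)
    (hF0 : ∀ i, (F i).trace = 0) {a : ℝ} (ha : 0 < a)
    (h : ∀ i X, ∑ j, (F i * F j).trace * (F j * X).trace = a * (F i * X).trace)
    (X : Matrix n n ℂ) :
    ∑ i, ‖(F i * X).trace‖ ^ 2 ≤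
      a * ((Xᴴ * X).trace.re - ‖X.trace‖ ^ 2 / Fintype.card n) := by
  have key := sum_norm_trace_mul_sq_le hF ha
    (X - (X.trace / Fintype.card n) • (1 : Matrix n n ℂ)) (fun i => h i _)
  have h1 : ∀ i, (F i * (X - (X.trace / Fintype.card n) • (1 : Matrix n n ℂ))).trace
      = (F i * X).trace := fun i => by simp [mul_sub, hF0]
  have hn : (Fintype.card n : ℂ) ≠ 0 := by simp
  have h2 : ((X - (X.trace / Fintype.card n) • (1 : Matrix n n ℂ))ᴴ *
      (X - (X.trace / Fintype.card n) • (1 : Matrix n n ℂ))).trace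
      = (Xᴴ * X).trace - ((‖X.trace‖ ^ 2 / Fintype.card n : ℝ) : ℂ) := by
    push_cast
    rw [← Complex.conj_mul']
    simp [mul_sub, sub_mul, trace_conjTranspose]
    field_simp
  simpa only [h1, h2, Complex.sub_re, Complex.ofReal_re] using key

/-- A Bessel bound for the Hilbert-Schmidt norms of a traceless tight frame compressed by `R`. -/
lemma sum_trace_conj_sq_le {ι n : Type*} [Fintype ι] [Fintype n]
    [DecidableEq n] [Nonempty n] {F : ι → Matrix n n ℂ} (hF : ∀ i, (F i).IsHermitian)
    (hF0 : ∀ i, (F i).trace = 0) {a : ℝ} (ha : 0 < a)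
    (h : ∀ i X, ∑ j, (F i * F j).trace * (F j * X).trace = a * (F i * X).trace)
    {R : Matrix n n ℂ} {σ : n → ℝ} (hR : Rᴴ * R = diagonal fun i => (σ i : ℂ)) :
    ∑ i, ((Rᴴ * F i * R) * (Rᴴ * F i * R)).trace.re ≤
      a * ((∑ i, σ i) ^ 2 - (∑ i, σ i ^ 2) / Fintype.card n) := by
  have hent : ∀ i p q, (Rᴴ * F i * R) p q = (F i * (R * single q p 1 * Rᴴ)).trace := by
    intro i p q
    rw [← mul_assoc, trace_mul_comm,
      show Rᴴ * (F i * (R * single q p 1)) = Rᴴ * F i * R * single q p 1 by simp only [mul_assoc],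
      trace_mul_single]
    simp
  have hsq : ∀ i, ((Rᴴ * F i * R) * (Rᴴ * F i * R)).trace.re
      = ∑ p, ∑ q, ‖(F i * (R * single q p 1 * Rᴴ)).trace‖ ^ 2 := by
    intro i
    have hH : (Rᴴ * F i * R).IsHermitian := isHermitian_conjTranspose_mul_mul R (hF i)
    simp only [trace, diag_apply, Complex.re_sum]
    refine Finset.sum_congr rfl fun p _ => ?_
    rw [mul_apply, Complex.re_sum]
    refine Finset.sum_congr rfl fun q _ => ?_
    have := hent i p q
    rw [trace] at this
    simp only [diag_apply] at this
    rw [← this, ← hH.apply q p, Complex.star_def, Complex.mul_conj', ← Complex.ofReal_pow,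
      Complex.ofReal_re]
  have htr : ∀ p q, (R * single q p 1 * Rᴴ).trace = if p = q then (σ p : ℂ) else 0 := by
    intro p q
    rw [trace_mul_comm, ← mul_assoc, hR, trace_mul_single]
    simp [diagonal_apply]
  have hnorm : ∀ p q, ((R * single q p 1 * Rᴴ)ᴴ * (R * single q p 1 * Rᴴ)).trace
      = ((σ p * σ q : ℝ) : ℂ) := by
    intro p q
    have : (R * single q p 1 * Rᴴ)ᴴ * (R * single q p 1 * Rᴴ)
        = R * (single p q 1 * (Rᴴ * R) * single q p 1 * Rᴴ) := by
      simp [mul_assoc]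
    rw [this, trace_mul_comm, mul_assoc, mul_assoc, hR]
    simp [mul_assoc, trace_single_mul]
    ring
  simp only [hsq]
  rw [Finset.sum_comm]
  simp only [fun p => Finset.sum_comm (s := Finset.univ) (t := Finset.univ)
    (f := fun i q => ‖(F i * (R * single q p 1 * Rᴴ)).trace‖ ^ 2)]
  calc _ ≤ ∑ p, ∑ q, a * (σ p * σ q - (if p = q then σ p ^ 2 else 0) / Fintype.card n) := by
        refine Finset.sum_le_sum fun p _ => Finset.sum_le_sum fun q _ => ?_
        refine (sum_norm_trace_mul_sq_le_of_trace_eq_zero hF hF0 ha h _).trans_eq ?_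
        rw [hnorm, htr, Complex.ofReal_re]
        split_ifs <;> simp
    _ = _ := by
        simp only [← Finset.mul_sum, Finset.sum_sub_distrib, ← Finset.sum_div]
        rw [sq (∑ i, σ i), Finset.sum_mul_sum]
        simp [Finset.mul_sum]

/-- A singular value decomposition, written as `B = R * Qᴴ` where the columns of `R` and of `Q`
are orthogonal and have the singular values `σ` as squared norms. -/
lemma exists_balanced_factorization {n : Type*} [Fintype n] [DecidableEq n] (B : Matrix n n ℂ) :
    ∃ (σ : n → ℝ) (R Q : Matrix n n ℂ), (∀ i, 0 ≤ σ i) ∧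
      Rᴴ * R = diagonal (fun i => (σ i : ℂ)) ∧ Qᴴ * Q = diagonal (fun i => (σ i : ℂ)) ∧
      B = R * Qᴴ ∧ Fintype.card {i // σ i ≠ 0} = B.rank ∧
      ((∑ i, σ i ^ 2 : ℝ) : ℂ) = (Bᴴ * B).trace := by
  have hA : (Bᴴ * B).IsHermitian := isHermitian_conjTranspose_mul_self B
  have hpos : ∀ i, 0 ≤ hA.eigenvalues i := (posSemidef_conjTranspose_mul_self B).eigenvalues_nonneg
  set V : Matrix n n ℂ := (hA.eigenvectorUnitary : Matrix n n ℂ) with hV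
  have hVV : Vᴴ * V = 1 := by
    simpa [star_eq_conjTranspose] using Unitary.coe_star_mul_self hA.eigenvectorUnitary
  have hVV' : V * Vᴴ = 1 := by
    simpa [star_eq_conjTranspose] using Unitary.coe_mul_star_self hA.eigenvectorUnitary
  have hspec : Vᴴ * Bᴴ * B * V = diagonal fun i => (hA.eigenvalues i : ℂ) := by
    have := hA.spectral_theorem
    rw [Unitary.conjStarAlgAut_apply] at this
    rw [← hV, star_eq_conjTranspose] at this
    calc Vᴴ * Bᴴ * B * V = Vᴴ * (Bᴴ * B) * V := by simp only [mul_assoc]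
      _ = Vᴴ * (V * diagonal (RCLike.ofReal ∘ hA.eigenvalues) * Vᴴ) * V :=
        congrArg (fun A => Vᴴ * A * V) this
      _ = (Vᴴ * V) * diagonal (RCLike.ofReal ∘ hA.eigenvalues) * (Vᴴ * V) := by
        simp only [mul_assoc]
      _ = _ := by
        rw [hVV, one_mul, mul_one]
        rfl
  set s : n → ℝ := fun i => √(√(hA.eigenvalues i)) with hs
  have hs2 : ∀ i, s i * s i = √(hA.eigenvalues i) := fun i => Real.mul_self_sqrt (Real.sqrt_nonneg _)
  have hs4 : ∀ i, hA.eigenvalues i = s i * s i * (s i * s i) := fun i => by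
    rw [hs2, Real.mul_self_sqrt (hpos i)]
  have hsand : ∀ f : n → ℝ, (B * V * diagonal fun i => (f i : ℂ))ᴴ *
      (B * V * diagonal fun i => (f i : ℂ)) =
      diagonal fun i => ((f i * hA.eigenvalues i * f i : ℝ) : ℂ) := by
    intro f
    rw [conjTranspose_mul, conjTranspose_mul, show ∀ D : Matrix n n ℂ, D * (Vᴴ * Bᴴ) *
      (B * V * diagonal fun i => (f i : ℂ)) = D * (Vᴴ * Bᴴ * B * V) * diagonal fun i => (f i : ℂ) by
        intro D; simp only [mul_assoc], hspec, diagonal_conjTranspose, diagonal_mul_diagonal,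
        diagonal_mul_diagonal]
    congr 1
    ext i
    simp
  refine ⟨fun i => √(hA.eigenvalues i), B * V * diagonal (fun i => ((s i)⁻¹ : ℝ) : n → ℂ),
    V * diagonal (fun i => (s i : ℂ)), fun i => Real.sqrt_nonneg _, ?_, ?_, ?_, ?_, ?_⟩
  · rw [hsand]
    congr 1
    ext i
    rw [hs4]
    dsimp only
    rw [← hs2]
    rcases eq_or_ne (s i) 0 with h0 | h0
    · simp [h0]
    · congr 1
      field_simp
  · rw [conjTranspose_mul, mul_assoc, ← mul_assoc Vᴴ, hVV, one_mul, diagonal_conjTranspose,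
      diagonal_mul_diagonal]
    congr 1
    ext i
    simp [← hs2]
  · have hzero : B * V * diagonal (fun i => ((1 - (s i)⁻¹ * s i : ℝ) : ℂ)) = 0 := by
      rw [← conjTranspose_mul_self_eq_zero, hsand]
      ext i j
      rw [diagonal_apply, hs4]
      rcases eq_or_ne (s i) 0 with h0 | h0 <;> simp [h0]
    rw [conjTranspose_mul, diagonal_conjTranspose]
    calc B = B * V * Vᴴ := by rw [mul_assoc, hVV', mul_one]
      _ = (B * V * diagonal (fun i => ((1 - (s i)⁻¹ * s i : ℝ) : ℂ)) +
          B * V * diagonal (fun i => (((s i)⁻¹ * s i : ℝ) : ℂ))) * Vᴴ := by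
        rw [← mul_add, diagonal_add]
        simp
      _ = _ := by
        rw [hzero, zero_add, ← mul_assoc, mul_assoc (B * V) (diagonal _) (diagonal _),
          diagonal_mul_diagonal]
        simp
  · rw [← rank_conjTranspose_mul_self, hA.rank_eq_card_non_zero_eigs]
    simp only [ne_eq, Real.sqrt_eq_zero (hpos _)]
  · rw [hA.trace_eq_sum_eigenvalues]
    push_cast
    exact Finset.sum_congr rfl fun i _ => by
      rw [← Complex.ofReal_pow, Real.sq_sqrt (hpos i)]; rfl

lemma sq_sum_le_card_ne_zero_mul_sum_sq {n : Type*} [Fintype n] (σ : n → ℝ) :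
    (∑ i, σ i) ^ 2 ≤ Fintype.card {i // σ i ≠ 0} * ∑ i, σ i ^ 2 := by
  classical
  rw [Fintype.card_subtype, ← Finset.sum_filter_ne_zero]
  refine sq_sum_le_card_mul_sum_sq.trans ?_
  gcongr
  exact Finset.filter_subset _ _

/-- Re-mixing by a real orthogonal matrix does not increase Hilbert-Schmidt correlations. -/
lemma sum_orthogonal_trace_mul_le {m n : Type*} [Fintype m] [DecidableEq m] [Fintype n]
    {O : Matrix m m ℝ} (hO : Oᵀ * O = 1) {X Y : m → Matrix n n ℂ}
    (hX : ∀ i, (X i).IsHermitian) (hY : ∀ i, (Y i).IsHermitian) :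
    2 * (∑ g, ∑ l, (O g l : ℂ) * (X g * Y l).trace).re ≤
      ∑ g, (X g * X g).trace.re + ∑ l, (Y l * Y l).trace.re := by
  set Z : m → Matrix n n ℂ := fun g => ∑ l, (O g l : ℂ) • Y l with hZ
  have hZH : ∀ g, (Z g)ᴴ = Z g := fun g => by
    simp [hZ, conjTranspose_sum, (hY _).eq]
  have hXZ : ∑ g, (X g * Z g).trace = ∑ g, ∑ l, (O g l : ℂ) * (X g * Y l).trace := by
    simp [hZ, Finset.mul_sum, trace_sum]
  have hZZ : ∑ g, (Z g * Z g).trace = ∑ l, (Y l * Y l).trace := by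
    have horth : ∀ l l', ∑ g, (O g l : ℂ) * (O g l' : ℂ) = if l = l' then 1 else 0 := by
      intro l l'
      have := congrFun (congrFun hO l) l'
      simp only [mul_apply, transpose_apply, one_apply] at this
      have h := congrArg (fun r : ℝ => (r : ℂ)) this
      rw [apply_ite Complex.ofReal] at h
      simpa using h
    calc ∑ g, (Z g * Z g).trace
        = ∑ g, ∑ l, ∑ l', (O g l : ℂ) * (O g l' : ℂ) * (Y l * Y l').trace := by
          refine Finset.sum_congr rfl fun g _ => ?_
          simp only [hZ, Finset.sum_mul, Finset.mul_sum, trace_sum, smul_mul_assoc, mul_smul_comm,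
            trace_smul, smul_eq_mul]
          rw [Finset.sum_comm]
          exact Finset.sum_congr rfl fun l _ => Finset.sum_congr rfl fun l' _ => by ring
      _ = ∑ l, ∑ l', (∑ g, (O g l : ℂ) * (O g l' : ℂ)) * (Y l * Y l').trace := by
          rw [Finset.sum_comm]
          refine Finset.sum_congr rfl fun l _ => ?_
          rw [Finset.sum_comm]
          exact Finset.sum_congr rfl fun l' _ => by rw [Finset.sum_mul]
      _ = _ := by simp [horth]
  have hnn : 0 ≤ ∑ g, ((X g - Z g) * (X g - Z g)).trace.re := by
    refine Finset.sum_nonneg fun g _ => ?_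
    have h := (posSemidef_conjTranspose_mul_self (X g - Z g)).trace_nonneg
    rw [conjTranspose_sub, hZH, (hX g).eq] at h
    exact (Complex.le_def.1 h).1
  have hexp : ∀ g, ((X g - Z g) * (X g - Z g)).trace
      = (X g * X g).trace + (Z g * Z g).trace - 2 * (X g * Z g).trace := fun g => by
    simp only [sub_mul, mul_sub, trace_sub, trace_mul_comm (Z g) (X g)]
    ring
  rw [← Complex.re_sum] at hnn
  simp only [hexp, Finset.sum_sub_distrib, Finset.sum_add_distrib, ← Finset.mul_sum, hXZ, hZZ] at hnn
  simp only [Complex.sub_re, Complex.add_re, Complex.re_sum, Complex.mul_re, Complex.re_ofNat,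
    Complex.im_ofNat, zero_mul, sub_zero] at hnn ⊢
  linarith

/-- The traceless part of an effect of trace `d / M`. -/
def centered {d : ℕ} (M : ℕ) (A : Matrix (Fin d) (Fin d) ℂ) : Matrix (Fin d) (Fin d) ℂ :=
  A - (M : ℂ)⁻¹ • 1

/-- The frame bound of the traceless parts of an (N,M)-POVM. -/
def frameBound (d M : ℕ) (x : ℝ) : ℝ := ((M : ℝ) ^ 2 * x - d) / (M * (M - 1))

lemma isHermitian_centered {d M : ℕ} {A : Matrix (Fin d) (Fin d) ℂ} (hA : A.IsHermitian) :
    (centered M A).IsHermitian := by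
  simp [centered, IsHermitian, hA.eq]

namespace IsICPOVM

variable {d N M : ℕ} {x : ℝ} {E : Fin N → Fin M → Matrix (Fin d) (Fin d) ℂ}

lemma isHermitian (hE : IsICPOVM d N M x E) (α : Fin N) (k : Fin M) : (E α k).IsHermitian :=
  (hE.1 α k).isHermitian

lemma trace_centered (hE : IsICPOVM d N M x E) (α : Fin N) (k : Fin M) :
    (centered M (E α k)).trace = 0 := by
  simp [centered, hE.2.2.1 α k]
  ring

lemma sum_centered (hE : IsICPOVM d N M x E) (hM : 2 ≤ M) (α : Fin N) :
    ∑ k, centered M (E α k) = 0 := by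
  have hM0 : (M : ℂ) ≠ 0 := by norm_cast; omega
  simp [centered, Finset.sum_sub_distrib, hE.2.1 α, ← Nat.cast_smul_eq_nsmul ℂ, smul_smul, hM0]

lemma trace_centered_mul (hE : IsICPOVM d N M x E) (hM : 2 ≤ M) (α β : Fin N) (k l : Fin M) :
    (centered M (E α k) * centered M (E β l)).trace =
      if α = β then (frameBound d M x : ℂ) * ((if k = l then 1 else 0) - (M : ℂ)⁻¹) else 0 := by
  have hM0 : (M : ℂ) ≠ 0 := by norm_cast; omega
  have hM1 : (M : ℂ) - 1 ≠ 0 := by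
    rw [sub_ne_zero]; norm_cast; omega
  obtain ⟨-, -, htr, hsq, hne, hab, -⟩ := hE
  have hgen : (centered M (E α k) * centered M (E β l)).trace
      = (E α k * E β l).trace - d / (M : ℂ) ^ 2 := by
    simp [centered, sub_mul, mul_sub, htr]
    field_simp
    ring
  rw [hgen, frameBound]
  push_cast
  split_ifs with h1 h2
  · subst h1 h2
    rw [hsq]
    field_simp
  · subst h1
    rw [hne _ _ _ h2]
    field_simp
    ring
  · rw [hab _ _ _ _ h1, sub_self]

lemma sum_trace_centered_mul (hE : IsICPOVM d N M x E) (hM : 2 ≤ M) (i : Fin N × Fin M)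
    (X : Matrix (Fin d) (Fin d) ℂ) :
    ∑ j : Fin N × Fin M, (centered M (E i.1 i.2) * centered M (E j.1 j.2)).trace *
      (centered M (E j.1 j.2) * X).trace
      = (frameBound d M x : ℂ) * (centered M (E i.1 i.2) * X).trace := by
  have h0 : ∑ l, (centered M (E i.1 l) * X).trace = 0 := by
    rw [← trace_sum, ← Finset.sum_mul, hE.sum_centered hM, zero_mul, trace_zero]
  rw [Fintype.sum_prod_type]
  simp only [hE.trace_centered_mul hM, ite_mul, zero_mul]
  rw [Finset.sum_comm]
  simp only [Finset.sum_ite_eq, Finset.mem_univ, if_true]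
  simp only [mul_sub, sub_mul, Finset.sum_sub_distrib, ← Finset.mul_sum, h0]
  simp

lemma frameBound_pos (hE : IsICPOVM d N M x E) (hM : 2 ≤ M) : 0 < frameBound d M x := by
  have hM' : (2 : ℝ) ≤ M := by exact_mod_cast hM
  have h := hE.2.2.2.2.2.2.1
  rw [div_lt_iff₀ (by positivity)] at h
  exact div_pos (by linarith) (mul_pos (by linarith) (by linarith))

lemma frameBound_le (hE : IsICPOVM d N M x E) (hM : 2 ≤ M) : frameBound d M x ≤ x := by
  have hM' : (2 : ℝ) ≤ M := by exact_mod_cast hM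
  have h := hE.2.2.2.2.2.2.2.trans (min_le_right _ _)
  rw [le_div_iff₀ (by positivity)] at h
  rw [frameBound, div_le_iff₀ (mul_pos (by linarith) (by linarith))]
  linarith

/-- Correlations of the traceless effects on a pure state with coefficient matrix `B`. -/
lemma sum_trace_centered_le (hE : IsICPOVM d N M x E) (hM : 2 ≤ M) (hd : 0 < d)
    {O : Fin N → Matrix (Fin M) (Fin M) ℝ} (hO : ∀ α, (O α)ᵀ * O α = 1) {k : ℕ}
    {B : Matrix (Fin d) (Fin d) ℂ} (hB : (Bᴴ * B).trace = 1) (hBk : B.rank ≤ k) :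
    (∑ α, ∑ g, ∑ l, (O α g l : ℂ) *
      (Bᴴ * (centered M (E α g) * B * centered M (E α l))).trace).re
      ≤ frameBound d M x * (k - 1 / d) := by
  have : Nonempty (Fin d) := ⟨⟨0, hd⟩⟩
  obtain ⟨σ, R, Q, hσ, hR, hQ, hRQ, hcard, hsum⟩ := exists_balanced_factorization B
  have hsum' : ∑ i, σ i ^ 2 = 1 := by
    rw [hB] at hsum
    exact_mod_cast hsum
  have ha := hE.frameBound_pos hM
  have hH : ∀ α g, (centered M (E α g)).IsHermitian := fun α g =>
    isHermitian_centered (hE.isHermitian α g)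
  have hbound : ∀ S : Matrix (Fin d) (Fin d) ℂ, Sᴴ * S = diagonal (fun i => (σ i : ℂ)) →
      ∑ α, ∑ g, ((Sᴴ * centered M (E α g) * S) * (Sᴴ * centered M (E α g) * S)).trace.re
        ≤ frameBound d M x * (k - 1 / d) := by
    intro S hS
    have h := sum_trace_conj_sq_le (F := fun i : Fin N × Fin M => centered M (E i.1 i.2))
      (fun i => hH i.1 i.2) (fun i => hE.trace_centered i.1 i.2) ha
      (fun i X => hE.sum_trace_centered_mul hM i X) hS
    rw [Fintype.sum_prod_type, hsum', Fintype.card_fin] at h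
    refine h.trans ?_
    gcongr
    refine (sq_sum_le_card_ne_zero_mul_sum_sq σ).trans ?_
    rw [hcard, hsum', mul_one]
    exact_mod_cast hBk
  have hterm : ∀ α g l, (Bᴴ * (centered M (E α g) * B * centered M (E α l))).trace
      = ((Rᴴ * centered M (E α g) * R) * (Qᴴ * centered M (E α l) * Q)).trace := by
    intro α g l
    rw [hRQ, conjTranspose_mul, conjTranspose_conjTranspose, mul_assoc Q, trace_mul_comm]
    simp only [mul_assoc]
  have hα : ∀ α, 2 * (∑ g, ∑ l, (O α g l : ℂ) *
      (Bᴴ * (centered M (E α g) * B * centered M (E α l))).trace).re ≤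
      ∑ g, ((Rᴴ * centered M (E α g) * R) * (Rᴴ * centered M (E α g) * R)).trace.re +
      ∑ l, ((Qᴴ * centered M (E α l) * Q) * (Qᴴ * centered M (E α l) * Q)).trace.re := by
    intro α
    simp only [hterm]
    exact sum_orthogonal_trace_mul_le (hO α)
      (fun g => isHermitian_conjTranspose_mul_mul R (hH α g))
      (fun l => isHermitian_conjTranspose_mul_mul Q (hH α l))
  have hsumα := Finset.sum_le_sum fun α (_ : α ∈ Finset.univ) => hα α
  rw [← Finset.mul_sum, ← Complex.re_sum, Finset.sum_add_distrib] at hsumα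
  linarith [hbound R hR, hbound Q hQ]

lemma sum_trace_eq (hE : IsICPOVM d N M x E) (hM : 2 ≤ M)
    {O : Fin N → Matrix (Fin M) (Fin M) ℝ} (hO : ∀ α, (O α)ᵀ * O α = 1)
    (hOnes : ∀ α, (O α).mulVec (fun _ => 1) = fun _ => 1)
    {B : Matrix (Fin d) (Fin d) ℂ} (hB : (Bᴴ * B).trace = 1) :
    ∑ α, ∑ g, ∑ l, (O α g l : ℂ) * (Bᴴ * (E α g * B * E α l)).trace
      = N / M + ∑ α, ∑ g, ∑ l, (O α g l : ℂ) *
        (Bᴴ * (centered M (E α g) * B * centered M (E α l))).trace := by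
  have hM0 : (M : ℂ) ≠ 0 := by norm_cast; omega
  have hrow : ∀ α g, ∑ l, (O α g l : ℂ) = 1 := by
    intro α g
    have := congrFun (hOnes α) g
    simp only [mulVec, dotProduct, mul_one] at this
    exact_mod_cast this
  have hcol : ∀ α l, ∑ g, (O α g l : ℂ) = 1 := by
    intro α l
    have h1 : (O α)ᵀ.mulVec (fun _ => 1) = fun _ => 1 := by
      conv_lhs => rw [← hOnes α, mulVec_mulVec, hO α, one_mulVec]
    have := congrFun h1 l
    simp only [mulVec, dotProduct, mul_one, transpose_apply] at this
    exact_mod_cast this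
  have hterm : ∀ α g l, (Bᴴ * (E α g * B * E α l)).trace
      = (Bᴴ * (centered M (E α g) * B * centered M (E α l))).trace
        + (M : ℂ)⁻¹ * (Bᴴ * (centered M (E α g) * B)).trace
        + (M : ℂ)⁻¹ * (Bᴴ * (B * centered M (E α l))).trace + ((M : ℂ)⁻¹) ^ 2 := by
    intro α g l
    have h1 : ∀ g, E α g = centered M (E α g) + (M : ℂ)⁻¹ • 1 := fun g => by simp [centered]
    rw [h1 g, h1 l]
    generalize hC : centered M (E α g) = C
    generalize hD : centered M (E α l) = D
    have h2 : ∀ A : Matrix (Fin d) (Fin d) ℂ, centered M (A + (M : ℂ)⁻¹ • 1) = A := fun A => by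
      simp [centered]
    rw [h2, h2]
    simp only [add_mul, mul_add, smul_mul_assoc, mul_smul_comm, one_mul, mul_one, trace_add,
      trace_smul, smul_eq_mul, hB]
    ring
  have hz1 : ∀ α, ∑ g, ∑ l, (O α g l : ℂ) *
      ((M : ℂ)⁻¹ * (Bᴴ * (centered M (E α g) * B)).trace) = 0 := by
    intro α
    simp only [← Finset.sum_mul, hrow, one_mul, ← Finset.mul_sum, ← trace_sum, hE.sum_centered hM]
    simp
  have hz2 : ∀ α, ∑ g, ∑ l, (O α g l : ℂ) *
      ((M : ℂ)⁻¹ * (Bᴴ * (B * centered M (E α l))).trace) = 0 := by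
    intro α
    rw [Finset.sum_comm]
    simp only [← Finset.sum_mul, hcol, one_mul, ← Finset.mul_sum, ← trace_sum, hE.sum_centered hM]
    simp
  simp only [hterm, mul_add, Finset.sum_add_distrib, hz1, hz2]
  simp only [← Finset.sum_mul, hrow]
  simp
  field_simp
  ring

lemma hx_mul_frameBound_le (hE : IsICPOVM d N M x E) (hM : 2 ≤ M) {k : ℕ}
    (hkd : 1 < (k : ℝ) * d) : hx d M k x * (frameBound d M x * (k * d - 1)) ≤ 1 := by
  have ha := hE.frameBound_pos hM
  have hax := hE.frameBound_le hM
  have hx0 : 0 < x := ha.trans_le hax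
  have hroot : ((M : ℝ) * ((M : ℝ) - 1)) / (x * ((M : ℝ) ^ 2 * x - d))
      = 1 / (x * frameBound d M x) := by
    rw [frameBound, mul_div_assoc', one_div_div]
  have hne : (k : ℝ) * d - 1 ≠ 0 := by linarith
  calc hx d M k x * (frameBound d M x * (k * d - 1))
      = √(1 / (x * frameBound d M x)) * frameBound d M x := by
        rw [hx, hroot]
        field_simp
    _ ≤ √(1 / (frameBound d M x * frameBound d M x)) * frameBound d M x := by
        gcongr
    _ = 1 := by
        rw [Real.sqrt_div zero_le_one, Real.sqrt_one, Real.sqrt_mul_self ha.le]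
        field_simp

end IsICPOVM

lemma hx_nonneg (d M k : ℕ) (x : ℝ) (hkd : 1 < (k : ℝ) * d) : 0 ≤ hx d M k x :=
  mul_nonneg (one_div_nonneg.2 (by linarith)) (Real.sqrt_nonneg _)

lemma trace_mul_proj {n : Type*} [Fintype n] (K : Matrix n n ℂ) (ψ : n → ℂ) :
    (K * proj ψ).trace = star ψ ⬝ᵥ K *ᵥ ψ := by
  rw [proj, mul_vecMulVec, trace_vecMulVec, dotProduct_comm]

lemma trace_kronecker_mul_proj_vec {n : Type*} [Fintype n] {A C : Matrix n n ℂ}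
    (hA : A.IsHermitian) (B : Matrix n n ℂ) :
    ((A.map (starRingEnd ℂ) ⊗ₖ C) * proj (vec B)).trace = (Bᴴ * (C * B * A)).trace := by
  have : (A.map (starRingEnd ℂ))ᵀ = A := by
    conv_rhs => rw [← hA.eq]
    rfl
  rw [trace_mul_proj, kronecker_mulVec_vec, star_vec_dotProduct_vec, this]

lemma isHermitian_wit {d N M : ℕ} {E : Fin N → Fin M → Matrix (Fin d) (Fin d) ℂ}
    (hE : ∀ α k, (E α k).IsHermitian) (O : Fin N → Matrix (Fin M) (Fin M) ℝ) (h : ℝ) :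
    (Wit E O h).IsHermitian := by
  have hmap : ∀ α l, ((E α l).map (starRingEnd ℂ))ᴴ = (E α l).map (starRingEnd ℂ) := by
    intro α l
    ext i j
    simpa using congrArg star ((hE α l).apply i j)
  simp only [Wit, IsHermitian, conjTranspose_sub, conjTranspose_smul, conjTranspose_one,
    conjTranspose_sum, conjTranspose_kronecker, hmap, (hE _ _).eq, Complex.star_def,
    Complex.conj_ofReal]

/-- The witness is nonnegative on pure states of Schmidt rank at most `k`. -/
lemma trace_wit_mul_proj_vec_nonneg {d N M k : ℕ} (hd : 2 ≤ d) (hM : 2 ≤ M) {x : ℝ}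
    {E : Fin N → Fin M → Matrix (Fin d) (Fin d) ℂ} (hE : IsICPOVM d N M x E)
    {O : Fin N → Matrix (Fin M) (Fin M) ℝ} (hO : ∀ α, (O α)ᵀ * O α = 1)
    (hOnes : ∀ α, (O α).mulVec (fun _ => 1) = fun _ => 1) (hk1 : 1 ≤ k)
    {B : Matrix (Fin d) (Fin d) ℂ} (hB : (Bᴴ * B).trace = 1) (hBk : B.rank ≤ k) :
    0 ≤ (Wit E O (hx d M k x) * proj (vec B)).trace.re := by
  have hd' : (2 : ℝ) ≤ d := by exact_mod_cast hd
  have hk' : (1 : ℝ) ≤ k := by exact_mod_cast hk1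
  have hM' : (2 : ℝ) ≤ M := by exact_mod_cast hM
  have hkd : 1 < (k : ℝ) * d := by nlinarith
  have hproj : (proj (vec B)).trace = 1 := by
    rw [proj, trace_vecMulVec, dotProduct_comm, star_vec_dotProduct_vec, hB]
  have hS := hE.sum_trace_centered_le hM (by omega) hO hB hBk
  set S := ∑ α, ∑ g, ∑ l, (O α g l : ℂ) *
      (Bᴴ * (centered M (E α g) * B * centered M (E α l))).trace
  have hW : (Wit E O (hx d M k x) * proj (vec B)).trace
      = (((M + N * d * hx d M k x) / (d * M) - hx d M k x * (N / M) : ℝ) : ℂ)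
        - (hx d M k x : ℝ) * S := by
    simp only [Wit, sub_mul, Finset.sum_mul, smul_mul_assoc, trace_sub, trace_smul, trace_sum,
      one_mul, hproj, smul_eq_mul, trace_kronecker_mul_proj_vec (hE.isHermitian _ _)]
    rw [hE.sum_trace_eq hM hO hOnes hB]
    push_cast
    ring
  have hh := hx_nonneg d M k x hkd
  have h1 := mul_le_mul_of_nonneg_left hS hh
  have h2 := hE.hx_mul_frameBound_le hM hkd
  rw [hW, Complex.sub_re, Complex.ofReal_re, Complex.re_ofReal_mul]
  have h3 : (M + N * d * hx d M k x) / (d * M) - hx d M k x * (N / M) = 1 / (d : ℝ) := by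
    field_simp
    ring
  have h4 : hx d M k x * (frameBound d M x * (k - 1 / d)) ≤ 1 / (d : ℝ) := by
    rw [le_div_iff₀ (by linarith)]
    have h5 : ((k : ℝ) - 1 / d) * d = k * d - 1 := by field_simp
    rwa [mul_assoc, mul_assoc, h5]
  linarith

/-- W_k is nonnegative on every density matrix of Schmidt number
at most k. -/
theorem witness_nonneg_on_schmidt_le (d N M k : ℕ) (hd : 2 ≤ d) (hN : 2 ≤ N) (hM : 2 ≤ M)
    (hdim : N * (M - 1) = d ^ 2 - 1) (x : ℝ)
    (E : Fin N → Fin M → Matrix (Fin d) (Fin d) ℂ) (hE : IsICPOVM d N M x E)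
    (O : Fin N → Matrix (Fin M) (Fin M) ℝ)
    (hO : ∀ α, (O α)ᵀ * O α = 1)
    (hOnes : ∀ α, (O α).mulVec (fun _ => 1) = fun _ => 1)
    (hk1 : 1 ≤ k) (hkd : k ≤ d)
    (ρ : Matrix (Fin d × Fin d) (Fin d × Fin d) ℂ)
    (hρpsd : ρ.PosSemidef) (hρtr : ρ.trace = 1)
    (hρSN : SchmidtNumberLE d k ρ) :
    0 ≤ (Wit E O (hx d M k x) * ρ).trace := by
  obtain ⟨n, p, ψ, hp, -, hψ, hrank, rfl⟩ := hρSN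
  rw [Complex.le_def]
  constructor
  · rw [Finset.mul_sum, trace_sum, Complex.re_sum]
    refine Finset.sum_nonneg fun i _ => ?_
    rw [mul_smul_comm, trace_smul, smul_eq_mul, Complex.re_ofReal_mul]
    refine mul_nonneg (hp i) ?_
    have hvec : ψ i = vec (Matrix.of fun a b => ψ i (a, b))ᵀ := rfl
    rw [hvec]
    refine trace_wit_mul_proj_vec_nonneg hd hM hE hO hOnes hk1 ?_ ?_
    · rw [← star_vec_dotProduct_vec, ← hvec, dotProduct]
      simp only [Pi.star_apply, Complex.star_def, Complex.conj_mul']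
      exact_mod_cast hψ i
    · rw [rank_transpose]
      exact hrank i
  · have hW := isHermitian_wit hE.isHermitian O (hx d M k x)
    have h : star (Wit E O (hx d M k x) * ∑ i, ((p i : ℝ) : ℂ) • proj (ψ i)).trace
        = (Wit E O (hx d M k x) * ∑ i, ((p i : ℝ) : ℂ) • proj (ψ i)).trace := by
      rw [← trace_conjTranspose, conjTranspose_mul, hW.eq, hρpsd.isHermitian.eq, trace_mul_comm]
    exact (Complex.conj_eq_iff_im.1 h).symm
end
end

section
/- Let d ≥ 2, N, M ≥ 2 be integers with N(M−1) = d²−1, let {E_{α,k}} be an informationally complete (N,M)-POVM on ℂ^d with parameter x, take O^{(α)} = I_M (the M×M identity) for every α, let 1 ≤ k ≤ d, let h_x = (1/(kd−1))·√(M(M−1)/(x(M²x−d))), set α₀ = (M+Nd·h_x)/(dM), and let W_k be the associated witness operator. For v ∈ (0,1] let ρ_v = v·|ψ_d⟩⟨ψ_d| + ((1−v)/d²)·I_{d²} with |ψ_d⟩ = (1/√d)·∑_{i=0}^{d−1}|i⟩⊗|i⟩. Then Tr(W_k ρ_v) = α₀ − N·h_x·(1−v)/M − x·v·h_x·N·M/d.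 -/
open Matrix Kronecker
open scoped ComplexOrder

noncomputable section

theorem trace_mul_proj_psiD {d : ℕ} (A : Matrix (Fin d × Fin d) (Fin d × Fin d) ℂ) :
    (A * proj (psiD d)).trace = (1 / d : ℂ) * ∑ i, ∑ j, A (i, i) (j, j) := by
  have hsq : (((Real.sqrt d : ℝ) : ℂ))⁻¹ * ((Real.sqrt d : ℝ) : ℂ)⁻¹ = (d : ℂ)⁻¹ := by
    rw [← mul_inv, ← Complex.ofReal_mul, Real.mul_self_sqrt (Nat.cast_nonneg d),
      Complex.ofReal_natCast]
  simp only [Matrix.trace, Matrix.diag, Matrix.mul_apply, proj, psiD, Matrix.vecMulVec_apply,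
    Fintype.sum_prod_type, Pi.star_apply, one_div, Finset.mul_sum, apply_ite star, star_zero,
    mul_ite, ite_mul, mul_zero, zero_mul, Complex.ofReal_inv, RCLike.star_def, map_inv₀, Complex.conj_ofReal,
    hsq]
  simp [mul_comm, Finset.sum_ite_irrel]

theorem trace_conj_kronecker_mul_proj_psiD {d : ℕ} {A : Matrix (Fin d) (Fin d) ℂ}
    (hA : A.IsHermitian) :
    ((A.map (starRingEnd ℂ) ⊗ₖ A) * proj (psiD d)).trace = (1 / d : ℂ) * (A * A).trace := by
  rw [trace_mul_proj_psiD]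
  congr 1
  simp only [Matrix.trace, Matrix.diag, Matrix.mul_apply, Matrix.kroneckerMap_apply,
    Matrix.map_apply]
  refine Finset.sum_congr rfl fun i _ => Finset.sum_congr rfl fun j _ => ?_
  rw [mul_comm, ← hA.apply j i]
  rfl

theorem trace_proj_psiD {d : ℕ} (hd : d ≠ 0) : (proj (psiD d)).trace = 1 := by
  have h := trace_mul_proj_psiD (1 : Matrix (Fin d × Fin d) (Fin d × Fin d) ℂ)
  have hd' : (d : ℂ) ≠ 0 := Nat.cast_ne_zero.mpr hd
  simpa [Matrix.one_apply, hd'] using h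

theorem trace_conj_kronecker {d : ℕ} {A : Matrix (Fin d) (Fin d) ℂ} (hA : A.IsHermitian) :
    (A.map (starRingEnd ℂ) ⊗ₖ A).trace = A.trace * A.trace := by
  have h : A.map (starRingEnd ℂ) = Aᵀ := by
    ext i j
    rw [Matrix.map_apply, Matrix.transpose_apply, ← hA.apply j i]
    rfl
  rw [Matrix.trace_kronecker, h, Matrix.trace_transpose]

theorem Wit_one {d N M : ℕ} (E : Fin N → Fin M → Matrix (Fin d) (Fin d) ℂ) (h : ℝ) :
    Wit E (fun _ => 1) h = ((((M : ℝ) + N * d * h) / (d * M) : ℝ) : ℂ) • 1 -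
      (h : ℂ) • ∑ α, ∑ g, (E α g).map (starRingEnd ℂ) ⊗ₖ E α g := by
  simp [Wit, Matrix.one_apply, apply_ite Complex.ofReal]

/-- with O^{(α)} = I_M, the value of Tr(W_k ρ_v) on the isotropic
state is α₀ − N·h_x·(1−v)/M − x·v·h_x·N·M/d. -/
theorem witness_on_isotropic_identity_rotations (d N M k : ℕ)
    (hd : 2 ≤ d) (hN : 2 ≤ N) (hM : 2 ≤ M)
    (hdim : N * (M - 1) = d ^ 2 - 1) (x : ℝ)
    (E : Fin N → Fin M → Matrix (Fin d) (Fin d) ℂ) (hE : IsICPOVM d N M x E)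
    (hk1 : 1 ≤ k) (hkd : k ≤ d)
    (v : ℝ) (hv0 : 0 < v) (hv1 : v ≤ 1) :
    (Wit E (fun _ => (1 : Matrix (Fin M) (Fin M) ℝ)) (hx d M k x) * isoState d v).trace =
      ((((M : ℝ) + N * d * hx d M k x) / (d * M) -
          (N : ℝ) * hx d M k x * (1 - v) / M -
          x * v * hx d M k x * N * M / d : ℝ) : ℂ) := by
  obtain ⟨hpos, -, htr, hsq, -⟩ := hE
  have hd' : (d : ℂ) ≠ 0 := Nat.cast_ne_zero.mpr (by omega)
  have hM' : (M : ℂ) ≠ 0 := Nat.cast_ne_zero.mpr (by omega)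
  have hproj : ∀ α g, ((E α g).map (starRingEnd ℂ) ⊗ₖ E α g * proj (psiD d)).trace =
      (1 / d : ℂ) * x := fun α g => by
    rw [trace_conj_kronecker_mul_proj_psiD (hpos α g).isHermitian, hsq]
  have hkron : ∀ α g, ((E α g).map (starRingEnd ℂ) ⊗ₖ E α g).trace =
      (d / M : ℂ) * (d / M) := fun α g => by
    rw [trace_conj_kronecker (hpos α g).isHermitian, htr]
  rw [Wit_one, isoState]
  generalize hx d M k x = h
  simp only [Matrix.mul_add, Matrix.sub_mul, Matrix.mul_smul, Matrix.smul_mul, Matrix.mul_one,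
    Matrix.one_mul, Matrix.sum_mul, Matrix.trace_add, Matrix.trace_sub, Matrix.trace_smul,
    Matrix.trace_sum, Matrix.trace_one, hproj, hkron, trace_proj_psiD (d := d) (by omega),
    Finset.sum_const, Finset.card_univ, Fintype.card_prod, Fintype.card_fin, nsmul_eq_mul,
    smul_eq_mul]
  push_cast
  field_simp
  ring
end
end
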